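/- Let d be a squarefree positive integer with discriminant Δ_d > (4·4!·4!·15⁴)², let F = ℚ(√d), and let L be a positive definite classic universal quadratic 𝒪_F-lattice. For each k = 1, 2, …, 15, choose v_k ∈ L with Q(v_k) = m_k + k·ω_d, where m_k = −⌊k·ω̄_d⌋. Then there exist four linearly independent vectors v₁', v₂', v₃', v₄' ∈ {v₁, …, v₁₅} such that, writing the Gram matrix (B(vᵢ', vⱼ'))_{4×4} = √(Δ_d)·(aᵢⱼ')_{4×4} + (εᵢⱼ')_{4×4} (entries viewed as real numbers via the embedding with √d > 0), with (aᵢⱼ') ∈ M₄(ℤ) satisfying |aᵢⱼ'| ≤ 15 and (εᵢⱼ') ∈ M₄(ℝ) satisfying |εᵢⱼ'| < 1, one has det((aᵢⱼ')_{4×4}) > 0. -/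

import Mathlib

noncomputable section

/-- `Δ_d`: the discriminant of `ℚ(√d)` for squarefree `d > 1`. -/
def Delta (d : ℕ) : ℕ := if d % 4 = 1 then d else 4 * d

/-- `ω_d`, viewed as a real number (with `√d > 0`). -/
def omegaR (d : ℕ) : ℝ := if d % 4 = 1 then (1 + Real.sqrt d) / 2 else Real.sqrt d

/-- The conjugate `ω̄_d`, viewed as a real number. -/
def omegaConjR (d : ℕ) : ℝ := if d % 4 = 1 then (1 - Real.sqrt d) / 2 else -Real.sqrt d

/-- `F = ℚ(√d)`, realized as an intermediate field of `ℝ/ℚ` via the embedding with `√d > 0`. -/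
def Fd (d : ℕ) : IntermediateField ℚ ℝ := IntermediateField.adjoin ℚ {Real.sqrt d}

/-- The ring of integers `𝒪_F` of `F = ℚ(√d)`. -/
abbrev Od (d : ℕ) := NumberField.RingOfIntegers (Fd d)

/-- An element of `F` is totally positive if its image under each of the
(two) real embeddings of `F` is positive. -/
def TotPos {d : ℕ} (x : Fd d) : Prop := ∀ σ : Fd d →ₐ[ℚ] ℝ, 0 < σ x

/-- The conjugate `x̄` of `x ∈ F = ℚ(√d)`, as a real number: `x̄ = tr(x) - x`. -/
def conjR {d : ℕ} (x : Fd d) : ℝ := ((Algebra.trace ℚ (Fd d) x : ℚ) : ℝ) - (x : ℝ)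

/-- A (not necessarily classic) quadratic `𝒪_F`-lattice: a finitely generated
`𝒪_F`-module `L` with a quadratic map `Q : L → 𝒪_F` whose associated form
`B(x,y) = (Q(x+y)-Q(x)-Q(y))/2` (with values a priori in `F`) is symmetric
bilinear and satisfies `B(x,x) = Q(x)`. -/
structure QuadLattice (d : ℕ) where
  carrier : Type
  [isAddCommGroup : AddCommGroup carrier]
  [isModule : Module (Od d) carrier]
  finite : Module.Finite (Od d) carrier
  Q : carrier → Od d
  B : carrier → carrier → Fd d
  B_symm : ∀ x y, B x y = B y x
  B_add_left : ∀ x y z, B (x + y) z = B x z + B y z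
  B_smul_left : ∀ (a : Od d) (x y : carrier), B (a • x) y = (a : Fd d) * B x y
  B_self : ∀ x, B x x = (Q x : Fd d)
  B_def : ∀ x y, 2 * B x y = (Q (x + y) : Fd d) - (Q x : Fd d) - (Q y : Fd d)

attribute [instance] QuadLattice.isAddCommGroup QuadLattice.isModule

namespace QuadLattice

variable {d : ℕ} (L : QuadLattice d)

/-- `L` is classic if the bilinear form takes values in `𝒪_F`. -/
def IsClassic : Prop := ∀ x y, L.B x y ∈ integralClosure ℤ (Fd d)

/-- `L` is positive definite if `Q(x)` is totally positive for all `x ≠ 0`. -/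
def PosDef : Prop := ∀ x : L.carrier, x ≠ 0 → TotPos (L.Q x : Fd d)

/-- `L` is universal if `Q(L) = 𝒪_F⁺ ∪ {0}`. -/
def Universal : Prop :=
  (Set.range fun v => L.Q v) = {a : Od d | TotPos (a : Fd d)} ∪ {0}

end QuadLattice

/-- A positive integer not represented by any classic ternary escalator lattice of
determinant `D`. -/
def truantOfDet (D : ℤ) : ℤ :=
  if D = 3 then 6 else if D = 6 ∨ D = 10 then 10 else if D = 2 ∨ D = 8 then 14 else 7

theorem ternary_escalator_gram_det_ne_zero :
    ∀ P ∈ Finset.Icc (1 : ℤ) 2, ∀ q ∈ Finset.Icc (0 : ℤ) 2, ∀ r ∈ Finset.Icc (0 : ℤ) 3,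
      0 ≤ P * (2 * P + 1 - q ^ 2) - r ^ 2 →
      ∀ x ∈ Finset.Icc (0 : ℤ) 3, ∀ y ∈ Finset.Icc (0 : ℤ) 5, ∀ z ∈ Finset.Icc (-8 : ℤ) 8,
      P * (2 * P + 1 - q ^ 2) * (truantOfDet (P * (2 * P + 1 - q ^ 2) - r ^ 2) - x ^ 2)
        + 2 * r * y * z - P * z ^ 2 - (2 * P + 1 - q ^ 2) * y ^ 2
        - (truantOfDet (P * (2 * P + 1 - q ^ 2) - r ^ 2) - x ^ 2) * r ^ 2 ≠ 0 := by
  decide +kernel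

theorem truantOfDet_eq (D : ℤ) :
    truantOfDet D = 6 ∨ truantOfDet D = 7 ∨ truantOfDet D = 10 ∨ truantOfDet D = 14 := by
  unfold truantOfDet
  split_ifs <;> simp

theorem det_four_of_first_eq_one (p q r x y z a b c : ℤ) :
    (!![1, p, q, x; p, a, r, y; q, r, b, z; x, y, z, c]).det =
      (a - p ^ 2) * (b - q ^ 2) * (c - x ^ 2) + 2 * (r - p * q) * (y - p * x) * (z - q * x)
        - (a - p ^ 2) * (z - q * x) ^ 2 - (b - q ^ 2) * (y - p * x) ^ 2
        - (c - x ^ 2) * (r - p * q) ^ 2 := by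
  rw [Matrix.det_succ_row_zero]
  simp [Fin.sum_univ_succ, Matrix.det_fin_three, Matrix.submatrix, Fin.succAbove]
  ring

theorem exists_four_gram_det_pos (a : Fin 15 → Fin 15 → ℤ) (hsymm : ∀ i j, a i j = a j i)
    (hdiag : ∀ k : Fin 15, a k k = (k : ℕ) + 1)
    (hnn : ∀ n ≤ 4, ∀ f : Fin n → Fin 15, 0 ≤ (Matrix.of fun i j => a (f i) (f j)).det) :
    ∃ f : Fin 4 → Fin 15, 0 < (Matrix.of fun i j => a (f i) (f j)).det := by
  have h2 : ∀ i j, a i j ^ 2 ≤ a i i * a j j := by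
    intro i j
    have := hnn 2 (by norm_num) ![i, j]
    rw [Matrix.det_fin_two] at this
    simp [hsymm j i] at this
    nlinarith
  have h00 : a 0 0 = 1 := by simp [hdiag]
  have h11 : a 1 1 = 2 := by simp [hdiag]
  have h3 : ∀ i j, (a i j - a 0 i * a 0 j) ^ 2 ≤ (a i i - a 0 i ^ 2) * (a j j - a 0 j ^ 2) := by
    intro i j
    have := hnn 3 (by norm_num) ![0, i, j]
    rw [Matrix.det_fin_three] at this
    simp [hsymm j i, hsymm i 0, hsymm j 0, h00] at this
    nlinarith
  set P := a 1 1 - a 0 1 ^ 2 with hP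
  have hP12 : P = 1 ∨ P = 2 := by
    have := h2 0 1
    rw [h00, h11] at this
    have h1 : a 0 1 ≤ 1 := by nlinarith
    have h2 : -1 ≤ a 0 1 := by nlinarith
    rw [hP, h11]
    interval_cases a 0 1 <;> simp
  obtain ⟨t, ht⟩ : ∃ t, a t t = 2 * P + 1 := by
    rcases hP12 with h | h
    · exact ⟨2, by rw [h, hdiag]; simp⟩
    · exact ⟨4, by rw [h, hdiag]; simp⟩
  obtain ⟨s, hs⟩ : ∃ s, a s s = truantOfDet
      (P * (2 * P + 1 - a 0 t ^ 2) - (a 1 t - a 0 1 * a 0 t) ^ 2) := by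
    rcases truantOfDet_eq (P * (2 * P + 1 - a 0 t ^ 2) - (a 1 t - a 0 1 * a 0 t) ^ 2) with
      h | h | h | h
    · exact ⟨5, by rw [h, hdiag]; simp⟩
    · exact ⟨6, by rw [h, hdiag]; simp⟩
    · exact ⟨9, by rw [h, hdiag]; simp⟩
    · exact ⟨13, by rw [h, hdiag]; simp⟩
  have hs14 : a s s ≤ 14 := by
    rcases truantOfDet_eq (P * (2 * P + 1 - a 0 t ^ 2) - (a 1 t - a 0 1 * a 0 t) ^ 2) with
      h | h | h | h <;>
        rw [hs, h] <;> norm_num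
  have hPt : P ≤ 2 := by omega
  have hP1 : 1 ≤ P := by omega
  have b1 := h2 0 t
  have b2 := h3 1 t
  have b3 := h2 0 s
  have b4 := h3 1 s
  have b5 := h3 t s
  rw [h00, one_mul] at b1 b3
  rw [← hP] at b2 b4
  have c1 : (a 1 t - a 0 1 * a 0 t) ^ 2 ≤ 10 := by nlinarith [sq_nonneg (a 0 t)]
  have c2 : (a 1 s - a 0 1 * a 0 s) ^ 2 ≤ 28 := by nlinarith [sq_nonneg (a 0 s)]
  have c3 : (a t s - a 0 t * a 0 s) ^ 2 ≤ 70 := by nlinarith [sq_nonneg (a 0 t), sq_nonneg (a 0 s)]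
  obtain ⟨z, hz2, hz⟩ : ∃ z, z ^ 2 = (a t s - a 0 t * a 0 s) ^ 2 ∧
      |a 1 t - a 0 1 * a 0 t| * |a 1 s - a 0 1 * a 0 s| * z =
        (a 1 t - a 0 1 * a 0 t) * (a 1 s - a 0 1 * a 0 s) * (a t s - a 0 t * a 0 s) := by
    rw [← abs_mul]
    rcases abs_choice ((a 1 t - a 0 1 * a 0 t) * (a 1 s - a 0 1 * a 0 s)) with h | h
    · exact ⟨_, rfl, by rw [h]⟩
    · exact ⟨-(a t s - a 0 t * a 0 s), neg_sq _, by rw [h, neg_mul_neg]⟩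
  have abs_mem : ∀ (n u : ℤ), 0 ≤ n → u ^ 2 < (n + 1) ^ 2 → |u| ∈ Finset.Icc 0 n := by
    intro n u hn hu
    have := abs_lt_of_sq_lt_sq hu (by omega)
    exact Finset.mem_Icc.2 ⟨abs_nonneg u, by omega⟩
  have key := ternary_escalator_gram_det_ne_zero P (Finset.mem_Icc.2 ⟨hP1, hPt⟩)
    |a 0 t| (abs_mem _ _ (by norm_num) (by linarith))
    |a 1 t - a 0 1 * a 0 t| (abs_mem _ _ (by norm_num) (by linarith))
    (by rw [sq_abs, sq_abs, ← ht]; linarith)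
    |a 0 s| (abs_mem _ _ (by norm_num) (by linarith))
    |a 1 s - a 0 1 * a 0 s| (abs_mem _ _ (by norm_num) (by linarith))
    z (Finset.mem_Icc.2 (abs_le.1 (Finset.mem_Icc.1
      (abs_mem 8 z (by norm_num) (by linarith))).2))
  simp only [sq_abs, hz2] at key
  refine ⟨![0, 1, t, s], lt_of_le_of_ne (hnn 4 le_rfl _) fun h => key ?_⟩
  have hM : (Matrix.of fun i j => a (![0, 1, t, s] i) (![0, 1, t, s] j)) =
      !![1, a 0 1, a 0 t, a 0 s; a 0 1, a 1 1, a 1 t, a 1 s; a 0 t, a 1 t, a t t, a t s;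
        a 0 s, a 1 s, a t s, a s s] := by
    ext i j
    fin_cases i <;> fin_cases j <;> simp [h00, hsymm 1 0, hsymm t 0, hsymm s 0, hsymm t 1,
      hsymm s 1, hsymm s t]
  rw [hM, det_four_of_first_eq_one, ← hP, ht, hs] at h
  linear_combination 2 * hz - h

theorem abs_prod_add_sub_prod_le {ι : Type*} (s : Finset ι) (a e : ι → ℝ) {M δ : ℝ}
    (hM : 0 ≤ M) (hδ : 0 ≤ δ) (ha : ∀ i, |a i| ≤ M) (he : ∀ i, |e i| ≤ δ) :
    |∏ i ∈ s, (a i + e i) - ∏ i ∈ s, a i| ≤ (M + δ) ^ s.card - M ^ s.card := by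
  classical
  induction s using Finset.induction_on with
  | empty => simp
  | insert j s hj ih =>
    rw [Finset.prod_insert hj, Finset.prod_insert hj, Finset.card_insert_of_notMem hj]
    have h1 : |∏ i ∈ s, a i| ≤ M ^ s.card := by
      rw [Finset.abs_prod]
      exact (Finset.prod_le_prod (fun i _ => abs_nonneg _) (fun i _ => ha i)).trans_eq (by simp)
    have h2 : |a j + e j| ≤ M + δ := (abs_add_le _ _).trans (add_le_add (ha j) (he j))
    calc |(a j + e j) * ∏ i ∈ s, (a i + e i) - a j * ∏ i ∈ s, a i|
        = |(a j + e j) * (∏ i ∈ s, (a i + e i) - ∏ i ∈ s, a i) + e j * ∏ i ∈ s, a i| := by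
          congr 1; ring
      _ ≤ |a j + e j| * |∏ i ∈ s, (a i + e i) - ∏ i ∈ s, a i| + |e j| * |∏ i ∈ s, a i| := by
          rw [← abs_mul, ← abs_mul]; exact abs_add_le _ _
      _ ≤ (M + δ) * ((M + δ) ^ s.card - M ^ s.card) + δ * M ^ s.card := by
          gcongr
          exact he j
      _ = _ := by ring

theorem abs_det_add_sub_det_le {n : ℕ} (A E : Matrix (Fin n) (Fin n) ℝ) {M δ : ℝ}
    (hM : 0 ≤ M) (hδ : 0 ≤ δ) (hA : ∀ i j, |A i j| ≤ M) (hE : ∀ i j, |E i j| ≤ δ) :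
    |(A + E).det - A.det| ≤ n.factorial * ((M + δ) ^ n - M ^ n) := by
  rw [Matrix.det_apply, Matrix.det_apply, ← Finset.sum_sub_distrib]
  refine (Finset.abs_sum_le_sum_abs _ _).trans ?_
  have key : ∀ τ ∈ (Finset.univ : Finset (Equiv.Perm (Fin n))),
      |Equiv.Perm.sign τ • ∏ i, (A + E) (τ i) i - Equiv.Perm.sign τ • ∏ i, A (τ i) i|
        ≤ (M + δ) ^ n - M ^ n := by
    intro τ _
    have := abs_prod_add_sub_prod_le (Finset.univ : Finset (Fin n)) (fun i => A (τ i) i)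
      (fun i => E (τ i) i) hM hδ (fun i => hA _ _) (fun i => hE _ _)
    rw [Finset.card_univ, Fintype.card_fin] at this
    rw [← smul_sub]
    rcases Int.units_eq_one_or (Equiv.Perm.sign τ) with h | h <;> rw [h]
    · simpa using this
    · rw [Units.neg_smul, abs_neg]
      simpa using this
  refine (Finset.sum_le_card_nsmul _ _ _ key).trans (le_of_eq ?_)
  rw [Finset.card_univ, Fintype.card_perm, Fintype.card_fin, nsmul_eq_mul]

theorem sqrt_irrational_of_squarefree {d : ℕ} (hd : Squarefree d) (hd1 : 1 < d) :
    Irrational (Real.sqrt d) := by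
  rw [irrational_sqrt_natCast_iff]
  rintro ⟨r, rfl⟩
  have := Nat.isUnit_iff.1 (hd r dvd_rfl)
  subst this
  omega

theorem isIntegral_sqrt_natCast (d : ℕ) : IsIntegral ℚ (Real.sqrt d) := by
  refine ⟨Polynomial.X ^ 2 - Polynomial.C (d : ℚ), Polynomial.monic_X_pow_sub_C _ two_ne_zero, ?_⟩
  simp

theorem minpoly_sqrt_natCast {d : ℕ} (h : Irrational (Real.sqrt d)) :
    minpoly ℚ (Real.sqrt d) = Polynomial.X ^ 2 - Polynomial.C (d : ℚ) := by
  symm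
  apply minpoly.eq_of_irreducible_of_monic
  · have hdeg : (Polynomial.X ^ 2 - Polynomial.C (d : ℚ)).natDegree = 2 :=
      Polynomial.natDegree_X_pow_sub_C
    refine Polynomial.irreducible_of_degree_le_three_of_not_isRoot (by rw [hdeg]; simp) ?_
    intro x hx
    simp only [Polynomial.IsRoot.def, Polynomial.eval_sub, Polynomial.eval_pow,
      Polynomial.eval_X, Polynomial.eval_C] at hx
    refine h ⟨|x|, ?_⟩
    have h1 : (x : ℝ) ^ 2 = d := by exact_mod_cast sub_eq_zero.1 hx
    rw [← h1, Real.sqrt_sq_eq_abs]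
    simp
  · simp
  · exact Polynomial.monic_X_pow_sub_C _ two_ne_zero

/-- The element `√d` of `ℚ(√d)`. -/
def sqrtGen (d : ℕ) : Fd d := IntermediateField.AdjoinSimple.gen ℚ (Real.sqrt d)

theorem coe_sqrtGen (d : ℕ) : ((sqrtGen d : Fd d) : ℝ) = Real.sqrt d := rfl

theorem exists_conj_algHom {d : ℕ} (h : Irrational (Real.sqrt d)) :
    ∃ σ : Fd d →ₐ[ℚ] ℝ, σ (sqrtGen d) = -Real.sqrt d := by
  have hint := isIntegral_sqrt_natCast d
  have key : Polynomial.aeval (-Real.sqrt d)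
      (minpoly ℚ (IntermediateField.adjoin.powerBasis hint).gen) = 0 := by
    have hmin : minpoly ℚ (IntermediateField.adjoin.powerBasis hint).gen =
        Polynomial.X ^ 2 - Polynomial.C (d : ℚ) := by
      rw [IntermediateField.adjoin.powerBasis_gen]
      exact (IntermediateField.minpoly_gen ℚ _).trans (minpoly_sqrt_natCast h)
    rw [hmin]
    simp
  exact ⟨(IntermediateField.adjoin.powerBasis hint).lift _ key,
    (IntermediateField.adjoin.powerBasis hint).lift_gen _ key⟩

theorem exists_eq_add_mul_sqrtGen {d : ℕ} (x : Fd d) :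
    ∃ p q : ℚ, x = (p : Fd d) + (q : Fd d) * sqrtGen d := by
  have hx : (x : ℝ) ∈ Algebra.adjoin ℚ {Real.sqrt d} := by
    rw [← IntermediateField.adjoin_simple_toSubalgebra_of_isAlgebraic
      (isIntegral_sqrt_natCast d).isAlgebraic]
    exact x.2
  suffices H : ∀ y ∈ Algebra.adjoin ℚ {Real.sqrt d}, ∃ p q : ℚ, y = p + q * Real.sqrt d by
    obtain ⟨p, q, hpq⟩ := H _ hx
    refine ⟨p, q, Subtype.ext ?_⟩
    push_cast
    rw [coe_sqrtGen, hpq]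
  have hsq : Real.sqrt d * Real.sqrt d = d := Real.mul_self_sqrt (Nat.cast_nonneg d)
  intro y hy
  induction hy using Algebra.adjoin_induction with
  | mem y hy => exact ⟨0, 1, by simpa using hy⟩
  | algebraMap r => exact ⟨r, 0, by simp⟩
  | add y z _ _ hy hz =>
    obtain ⟨p, q, rfl⟩ := hy
    obtain ⟨p', q', rfl⟩ := hz
    exact ⟨p + p', q + q', by push_cast; ring⟩
  | mul y z _ _ hy hz =>
    obtain ⟨p, q, rfl⟩ := hy
    obtain ⟨p', q', rfl⟩ := hz
    exact ⟨p * p' + q * q' * d, p * q' + q * p', by push_cast; linear_combination q * q' * hsq⟩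

theorem Rat.exists_int_of_isIntegral_real {r : ℚ} (h : IsIntegral ℤ (r : ℝ)) :
    ∃ n : ℤ, (n : ℚ) = r := by
  have h' : IsIntegral ℤ r := by
    rw [← isIntegral_algebraMap_iff (algebraMap ℚ ℝ).injective]
    simpa using h
  obtain ⟨n, hn⟩ := IsIntegrallyClosed.isIntegral_iff.1 h'
  exact ⟨n, by simpa using hn⟩

theorem omegaR_sub_omegaConjR (d : ℕ) : omegaR d - omegaConjR d = Real.sqrt (Delta d) := by
  unfold omegaR omegaConjR Delta
  split_ifs
  · ring
  · have : Real.sqrt 4 = 2 := by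
      rw [show (4 : ℝ) = 2 ^ 2 by norm_num]; exact Real.sqrt_sq (by norm_num)
    push_cast
    rw [Real.sqrt_mul (by norm_num), this]
    ring

theorem exists_int_sub_conj {d : ℕ} (hd : Squarefree d) {σ : Fd d →ₐ[ℚ] ℝ}
    (hσ : σ (sqrtGen d) = -Real.sqrt d) {x : Fd d} (hx : IsIntegral ℤ x) :
    ∃ n : ℤ, (x : ℝ) = Real.sqrt (Delta d) * n + σ x := by
  have h1 : IsIntegral ℤ (x : ℝ) := hx.map ((Fd d).val.restrictScalars ℤ)
  have h2 : IsIntegral ℤ (σ x) := hx.map (σ.restrictScalars ℤ)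
  obtain ⟨p, q, rfl⟩ := exists_eq_add_mul_sqrtGen x
  have hsq : Real.sqrt d * Real.sqrt d = d := Real.mul_self_sqrt (Nat.cast_nonneg d)
  have e2 : σ ((p : Fd d) + (q : Fd d) * sqrtGen d) = p - q * Real.sqrt d := by
    rw [map_add, map_mul, hσ, map_ratCast, map_ratCast]; ring
  have e1 : (((p : Fd d) + (q : Fd d) * sqrtGen d : Fd d) : ℝ) = p + q * Real.sqrt d := by
    push_cast
    rw [coe_sqrtGen]
  rw [e1] at h1 ⊢
  rw [e2] at h2 ⊢
  obtain ⟨s, hs⟩ := Rat.exists_int_of_isIntegral_real (r := 2 * p)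
    (by
    have : ((2 * p : ℚ) : ℝ) = (p + q * Real.sqrt d) + (p - q * Real.sqrt d) := by
      push_cast; ring
    rw [this]
    exact h1.add h2)
  obtain ⟨m, hm⟩ := Rat.exists_int_of_isIntegral_real (r := p ^ 2 - d * q ^ 2)
    (by
    have : ((p ^ 2 - d * q ^ 2 : ℚ) : ℝ) =
        (p + q * Real.sqrt d) * (p - q * Real.sqrt d) := by
      push_cast; linear_combination (q : ℝ) ^ 2 * hsq
    rw [this]
    exact h1.mul h2)
  have hd0 : (d : ℚ) ≠ 0 := by exact_mod_cast hd.ne_zero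
  have hk : (2 * q * d) ^ 2 = ((d * (s ^ 2 - 4 * m) : ℤ) : ℚ) := by
    push_cast
    rw [hs, hm]
    ring
  obtain ⟨k, hk'⟩ := Rat.exists_int_of_isIntegral_real (r := 2 * q * d) (by
    refine IsIntegral.of_pow (n := 2) two_pos ?_
    have : (((2 * q * d : ℚ) : ℝ)) ^ 2 = ((d * (s ^ 2 - 4 * m) : ℤ) : ℝ) := by exact_mod_cast hk
    rw [this]
    exact isIntegral_algebraMap (R := ℤ) (x := (d * (s ^ 2 - 4 * m) : ℤ)))
  rw [← hk'] at hk
  have hdvd : (d : ℤ) ∣ k := by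
    rw [← (Int.squarefree_natCast.2 hd).dvd_pow_iff_dvd two_ne_zero]
    exact ⟨_, by exact_mod_cast hk⟩
  obtain ⟨t, rfl⟩ := hdvd
  have ht : (t : ℚ) = 2 * q := by
    push_cast at hk'
    exact mul_left_cancel₀ hd0 (by rw [hk']; ring)
  have hst : s ^ 2 - d * t ^ 2 = 4 * m := by
    have : (s : ℚ) ^ 2 - d * t ^ 2 = 4 * m := by rw [hs, hm, ht]; ring
    exact_mod_cast this
  have htR : (t : ℝ) = 2 * q := by exact_mod_cast ht
  unfold Delta
  split_ifs with h4
  · exact ⟨t, by rw [htR]; ring⟩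
  · have h40 : d % 4 ≠ 0 := fun h => by
      have := Nat.isUnit_iff.1 (hd 2 (Nat.dvd_of_mod_eq_zero h))
      omega
    have hteven : 2 ∣ t := by
      have h23 : (d : ℤ) % 4 = 2 ∨ (d : ℤ) % 4 = 3 := by omega
      have hmod : (s ^ 2 - d * t ^ 2) % 4 = 0 := by rw [hst]; omega
      have hs4 : s % 4 = 0 ∨ s % 4 = 1 ∨ s % 4 = 2 ∨ s % 4 = 3 := by omega
      have ht4 : t % 4 = 0 ∨ t % 4 = 1 ∨ t % 4 = 2 ∨ t % 4 = 3 := by omega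
      rcases h23 with h | h <;> rcases hs4 with h' | h' | h' | h' <;>
        rcases ht4 with h'' | h'' | h'' | h'' <;>
        simp [Int.sub_emod, Int.mul_emod, pow_two, h, h', h''] at hmod <;> omega
    obtain ⟨u, rfl⟩ := hteven
    refine ⟨u, ?_⟩
    have h42 : Real.sqrt 4 = 2 := by
      rw [show (4 : ℝ) = 2 ^ 2 by norm_num]; exact Real.sqrt_sq (by norm_num)
    push_cast at htR ⊢
    rw [Real.sqrt_mul (by norm_num), h42]
    linear_combination -Real.sqrt d * htR

theorem map_eq_add_mul_omegaConjR {d : ℕ} {σ : Fd d →ₐ[ℚ] ℝ}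
    (hσ : σ (sqrtGen d) = -Real.sqrt d) {x : Fd d} {m : ℤ} {k : ℕ}
    (hx : (x : ℝ) = m + k * omegaR d) : σ x = m + k * omegaConjR d := by
  have hω : ∃ w : Fd d, (w : ℝ) = omegaR d ∧ σ w = omegaConjR d := by
    unfold omegaR omegaConjR
    split_ifs
    · refine ⟨(1 + sqrtGen d) / 2, ?_, ?_⟩
      · rw [← coe_sqrtGen]
        rfl
      · rw [map_div₀, map_add, hσ, map_one, map_ofNat]
        ring
    · exact ⟨sqrtGen d, rfl, hσ⟩
  obtain ⟨w, hw, hw'⟩ := hω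
  have : x = (m : Fd d) + (k : Fd d) * w := Subtype.ext (by push_cast; rw [hx, hw])
  rw [this, map_add, map_mul, hw', map_intCast, map_natCast]

open Matrix in
theorem Matrix.posSemidef_of_int_dotProduct_mulVec_nonneg {n : Type*} [Fintype n]
    {M : Matrix n n ℝ} (hM : M.IsHermitian)
    (h : ∀ z : n → ℤ, 0 ≤ (fun i => (z i : ℝ)) ⬝ᵥ M *ᵥ (fun i => (z i : ℝ))) :
    M.PosSemidef := by
  refine Matrix.PosSemidef.of_dotProduct_mulVec_nonneg hM fun x => ?_
  rw [star_trivial]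
  have hdense : DenseRange (fun (q : n → ℚ) (i : n) => (q i : ℝ)) :=
    DenseRange.piMap fun _ => Rat.denseRange_cast
  refine hdense.induction_on (p := fun x => 0 ≤ x ⬝ᵥ M *ᵥ x) x ?_ fun q => ?_
  · refine isClosed_le continuous_const ?_
    fun_prop
  · obtain ⟨b, hb⟩ := IsLocalization.exist_integer_multiples_of_finite
      (nonZeroDivisors ℤ) q
    choose z hz using hb
    have hb0 : ((b : ℤ) : ℝ) ≠ 0 := by exact_mod_cast nonZeroDivisors.coe_ne_zero b
    have hzq : (fun i => (z i : ℝ)) = ((b : ℤ) : ℝ) • fun i => (q i : ℝ) := by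
      funext i
      have := hz i
      simp only [eq_intCast, zsmul_eq_mul] at this
      simp only [Pi.smul_apply, smul_eq_mul]
      exact_mod_cast this
    have := h z
    rw [hzq, Matrix.mulVec_smul, dotProduct_smul, smul_dotProduct, smul_eq_mul, smul_eq_mul,
      ← mul_assoc] at this
    exact nonneg_of_mul_nonneg_right this (mul_self_pos.2 hb0)

namespace QuadLattice

variable {d : ℕ} (L : QuadLattice d)

theorem B_sum_smul_left {ι : Type*} (s : Finset ι) (c : ι → Od d) (w : ι → L.carrier)
    (y : L.carrier) :
    L.B (∑ i ∈ s, c i • w i) y = ∑ i ∈ s, (c i : Fd d) * L.B (w i) y := by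
  refine (map_sum (AddMonoidHom.mk' (fun x => L.B x y) fun x z => L.B_add_left x z y)
    (fun i => c i • w i) s).trans ?_
  exact Finset.sum_congr rfl fun i _ => L.B_smul_left _ _ _

theorem B_zero_left (y : L.carrier) : L.B 0 y = 0 := by
  simpa using L.B_smul_left 0 0 y

theorem PosDef.map_B_self_nonneg {L : QuadLattice d} (hpd : L.PosDef) (σ : Fd d →ₐ[ℚ] ℝ)
    (x : L.carrier) : 0 ≤ σ (L.B x x) := by
  by_cases hx : x = 0
  · rw [hx, L.B_zero_left, map_zero]
  · rw [L.B_self]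
    exact (hpd x hx σ).le

theorem PosDef.posSemidef_gram {L : QuadLattice d} (hpd : L.PosDef) (σ : Fd d →ₐ[ℚ] ℝ)
    {n : Type*} [Fintype n] (w : n → L.carrier) :
    (Matrix.of fun i j => σ (L.B (w i) (w j))).PosSemidef := by
  refine Matrix.posSemidef_of_int_dotProduct_mulVec_nonneg
    (Matrix.IsHermitian.ext fun i j => by simp [L.B_symm (w i)]) fun z => ?_
  have h := hpd.map_B_self_nonneg σ (∑ i, (z i : Od d) • w i)
  rw [B_sum_smul_left, map_sum] at h
  refine h.trans_eq (Finset.sum_congr rfl fun i _ => ?_)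
  rw [map_mul, L.B_symm, B_sum_smul_left, map_sum, Matrix.mulVec, dotProduct]
  congr 1
  · simp
  · refine Finset.sum_congr rfl fun j _ => ?_
    rw [map_mul, L.B_symm, mul_comm]
    simp

theorem PosDef.sq_map_B_le {L : QuadLattice d} (hpd : L.PosDef) (σ : Fd d →ₐ[ℚ] ℝ)
    (x y : L.carrier) : σ (L.B x y) ^ 2 ≤ σ (L.B x x) * σ (L.B y y) := by
  have h := (hpd.posSemidef_gram σ ![x, y]).det_nonneg
  rw [Matrix.det_fin_two] at h
  simp only [Matrix.of_apply, Matrix.cons_val_zero, Matrix.cons_val_one, L.B_symm y x] at h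
  linarith

theorem linearIndependent_of_gram_det_ne_zero {n : Type*} [Fintype n] [DecidableEq n]
    (w : n → L.carrier) (h : (Matrix.of fun i j => L.B (w i) (w j)).det ≠ 0) :
    LinearIndependent (Od d) w := by
  rw [Fintype.linearIndependent_iff]
  intro c hc
  have h0 := Matrix.eq_zero_of_vecMul_eq_zero h (v := fun i => (c i : Fd d)) (by
    funext j
    simp only [Matrix.vecMul, dotProduct, Matrix.of_apply, Pi.zero_apply]
    rw [← B_sum_smul_left, hc, B_zero_left])
  intro i
  exact NumberField.RingOfIntegers.coe_eq_zero_iff.1 (congrFun h0 i)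

end QuadLattice

/-- **Lemma (Statement 13).** Let `Δ_d > (4·4!·4!·15⁴)²` and let `L` be a positive
definite classic universal quadratic `𝒪_F`-lattice, and for `k = 1, …, 15` let
`v_k ∈ L` with `Q(v_k) = m_k + k·ω_d` where `m_k = -⌊k·ω̄_d⌋`. Then there are four
linearly independent vectors `v₁', …, v₄'` among `v₁, …, v₁₅` whose Gram matrix
decomposes as `√Δ_d·(aᵢⱼ') + (εᵢⱼ')` with `(aᵢⱼ') ∈ M₄(ℤ)`, `|aᵢⱼ'| ≤ 15`,
`|εᵢⱼ'| < 1` and `det (aᵢⱼ') > 0`. -/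
theorem exists_four_linearIndependent_gram_det_pos
    (d : ℕ) (hd : Squarefree d) (hd1 : 1 < d)
    (hΔ : (4 * Nat.factorial 4 * Nat.factorial 4 * 15 ^ 4) ^ 2 < Delta d)
    (L : QuadLattice d) (hcl : L.IsClassic) (hpd : L.PosDef) (hun : L.Universal)
    (v : Fin 15 → L.carrier)
    (hv : ∀ k : Fin 15, ((L.Q (v k) : Fd d) : ℝ)
        = ((-⌊(((k : ℕ) + 1 : ℕ) : ℝ) * omegaConjR d⌋ : ℤ) : ℝ)
            + (((k : ℕ) + 1 : ℕ) : ℝ) * omegaR d) :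
    ∃ (f : Fin 4 → Fin 15) (a : Matrix (Fin 4) (Fin 4) ℤ)
      (ε : Matrix (Fin 4) (Fin 4) ℝ),
      LinearIndependent (Od d) (fun i => v (f i)) ∧
      (∀ i j, ((L.B (v (f i)) (v (f j))) : ℝ)
          = Real.sqrt (Delta d) * (a i j : ℝ) + ε i j) ∧
      (∀ i j, |a i j| ≤ 15) ∧ (∀ i j, |ε i j| < 1) ∧ 0 < a.det := by
  have hirr := sqrt_irrational_of_squarefree hd hd1
  obtain ⟨σ, hσ⟩ := exists_conj_algHom hirr
  set s := Real.sqrt (Delta d) with hs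
  have hs_large : 100000000 < s := by
    rw [hs]
    apply Real.lt_sqrt_of_sq_lt
    refine lt_trans ?_ (Nat.cast_lt.2 hΔ)
    norm_num [Nat.factorial]
  have hs0 : 0 < s := by linarith
  choose a ha using fun i j => exists_int_sub_conj hd hσ (hcl (v i) (v j))
  rw [← hs] at ha
  have hσQ : ∀ k, σ (L.B (v k) (v k)) = Int.fract ((((k : ℕ) + 1 : ℕ) : ℝ) * omegaConjR d) := by
    intro k
    rw [L.B_self, map_eq_add_mul_omegaConjR hσ (hv k), Int.fract]
    push_cast
    ring
  have hσB : ∀ i j, |σ (L.B (v i) (v j))| < 1 := by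
    intro i j
    rw [← sq_lt_one_iff_abs_lt_one]
    refine (hpd.sq_map_B_le σ (v i) (v j)).trans_lt ?_
    rw [hσQ, hσQ]
    exact mul_lt_one_of_nonneg_of_lt_one_left (Int.fract_nonneg _) (Int.fract_lt_one _)
      (Int.fract_lt_one _).le
  have hdiag : ∀ k : Fin 15, a k k = (k : ℕ) + 1 := by
    intro k
    have h1 := ha k k
    rw [hσQ, L.B_self, hv k, Int.fract] at h1
    have h2 : s * (a k k : ℝ) = s * (((k : ℕ) + 1 : ℕ) : ℝ) := by
      rw [hs, ← omegaR_sub_omegaConjR] at h1 ⊢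
      push_cast at h1 ⊢
      linarith
    exact_mod_cast mul_left_cancel₀ hs0.ne' h2
  have hsymm : ∀ i j, a i j = a j i := by
    intro i j
    have h1 := ha i j
    rw [L.B_symm, ha j i] at h1
    have := mul_left_cancel₀ hs0.ne' (add_right_cancel h1)
    exact_mod_cast this.symm
  have hbound : ∀ i j, |a i j| ≤ 15 := by
    intro i j
    have hB : ∀ k, ((L.B (v k) (v k) : Fd d) : ℝ) ≤ 15 * s + 1 := by
      intro k
      rw [ha k k, hdiag]
      have h1 := (abs_lt.1 (hσB k k)).2
      have h2 : ((((k : ℕ) : ℤ) + 1 : ℤ) : ℝ) ≤ 15 := by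
        have := k.2
        exact_mod_cast (by omega : ((k : ℕ) : ℤ) + 1 ≤ 15)
      nlinarith
    have h1 : ((L.B (v i) (v j) : Fd d) : ℝ) ^ 2 ≤ (15 * s + 1) ^ 2 := by
      refine (hpd.sq_map_B_le (Fd d).val (v i) (v j)).trans ?_
      rw [pow_two]
      exact mul_le_mul (hB i) (hB j) (hpd.map_B_self_nonneg (Fd d).val _) (by linarith)
    have h2 := abs_le_of_sq_le_sq h1 (by linarith)
    rw [ha i j] at h2
    have h3 := abs_lt.1 (hσB i j)
    have h4 : |(a i j : ℝ)| < 16 := by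
      have := abs_le.1 h2
      rw [abs_lt]
      constructor <;> nlinarith
    have h5 : |a i j| < 16 := by exact_mod_cast h4
    omega
  have hgram : ∀ (n : ℕ) (f : Fin n → Fin 15), n ≤ 4 →
      ∃ r : ℝ, (Matrix.of fun i j => (Fd d).val (L.B (v (f i)) (v (f j)))).det = s ^ n * r ∧
        |r - ((Matrix.of fun i j => a (f i) (f j)).det : ℤ)| < 1 := by
    intro n f hn
    refine ⟨((Matrix.of fun i j => (a (f i) (f j) : ℝ)) +
      Matrix.of fun i j => s⁻¹ * σ (L.B (v (f i)) (v (f j)))).det, ?_, ?_⟩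
    · have : (Matrix.of fun i j => (Fd d).val (L.B (v (f i)) (v (f j)))) =
          s • ((Matrix.of fun i j => (a (f i) (f j) : ℝ)) +
            Matrix.of fun i j => s⁻¹ * σ (L.B (v (f i)) (v (f j)))) := by
        ext i j
        simp only [Matrix.of_apply, Matrix.smul_apply, Matrix.add_apply, smul_eq_mul, mul_add]
        rw [mul_inv_cancel_left₀ hs0.ne']
        exact ha _ _
      rw [this, Matrix.det_smul, Fintype.card_fin]
    · have hδ : s⁻¹ ≤ 1 / 100000000 := by
        rw [one_div]
        exact inv_anti₀ (by norm_num) hs_large.le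
      have hdet : (((Matrix.of fun i j => a (f i) (f j)).det : ℤ) : ℝ) =
          (Matrix.of fun i j => (a (f i) (f j) : ℝ)).det := Int.cast_det _
      rw [hdet]
      refine (abs_det_add_sub_det_le (M := 15) (δ := 1 / 100000000) _ _ (by norm_num)
        (by norm_num) (fun i j => ?_) (fun i j => ?_)).trans_lt ?_
      · rw [Matrix.of_apply]
        exact_mod_cast hbound _ _
      · rw [Matrix.of_apply, abs_mul, abs_of_pos (inv_pos.2 hs0)]
        exact (mul_le_of_le_one_right (inv_pos.2 hs0).le (hσB _ _).le).trans hδ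
      · interval_cases n <;> norm_num [Nat.factorial]
  obtain ⟨f, hf⟩ := exists_four_gram_det_pos a hsymm hdiag fun n hn f => by
    obtain ⟨r, hr, hr'⟩ := hgram n f hn
    have h0 := (hpd.posSemidef_gram (Fd d).val fun i => v (f i)).det_nonneg
    have h1 : 0 ≤ r := nonneg_of_mul_nonneg_right (h0.trans_eq hr) (pow_pos hs0 n)
    have h2 : (-1 : ℝ) < ((Matrix.of fun i j => a (f i) (f j)).det : ℤ) := by
      linarith [(abs_lt.1 hr').2]
    have h3 : -1 < (Matrix.of fun i j => a (f i) (f j)).det := by exact_mod_cast h2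
    omega
  refine ⟨f, Matrix.of fun i j => a (f i) (f j),
    Matrix.of fun i j => σ (L.B (v (f i)) (v (f j))),
    L.linearIndependent_of_gram_det_ne_zero _ fun h => ?_, fun i j => ha _ _,
    fun i j => hbound _ _, fun i j => hσB _ _, hf⟩
  obtain ⟨r, hr, hr'⟩ := hgram 4 f le_rfl
  have h0 : (Matrix.of fun i j => (Fd d).val (L.B (v (f i)) (v (f j)))).det = 0 := by
    have := AlgHom.map_det (Fd d).val (Matrix.of fun i j => L.B (v (f i)) (v (f j)))
    rw [h, map_zero] at this
    exact this.symm
  rw [h0] at hr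
  have hr0 : r = 0 := (mul_eq_zero.1 hr.symm).resolve_left (pow_ne_zero 4 hs0.ne')
  rw [hr0, zero_sub, abs_neg] at hr'
  have h1 := (abs_lt.1 hr').2
  have h2 : (Matrix.of fun i j => a (f i) (f j)).det < 1 := by exact_mod_cast h1
  omega
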